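/- Let 0 < t₁ < t₂ < π, q ∈ (−1, 1), and suppose t₁*, t₂* ∈ (0, π) satisfy T_q(e^{it₁}) = e^{it₁*} and T_q(e^{it₂}) = e^{it₂*}, where T_q(z) = (z − q)/(1 − qz). Then for every z ∈ 𝔻, ψ_{0,(t₁,t₂)}(z) = ψ_{0,(t₁*,t₂*)}(T_q(z)) · (T_q'(z))². -/

import Mathlib

noncomputable def ψ₁ (t₁ t₂ : ℝ) (z : ℂ) : ℂ :=
  4 * (Real.cos t₂ - Real.cos t₁) /
    ((z ^ 2 - 2 * z * Real.cos t₁ + 1) * (z ^ 2 - 2 * z * Real.cos t₂ + 1))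

noncomputable def ψ₀ (t₁ t₂ : ℝ) (z : ℂ) : ℂ :=
  (((3 * Real.cos (2 * t₁) - 5 * Real.cos (2 * t₂) + 2) / 8) * z ^ 4
    + (3 * Real.sin t₁ ^ 2 * Real.cos t₂ - 5 * Real.cos t₁ * Real.sin t₂ ^ 2) * z ^ 3
    + ((Real.cos (2 * t₁) * (11 - 2 * Real.cos (2 * t₂)) - 13 * Real.cos (2 * t₂) + 4) / 4) * z ^ 2
    + (3 * Real.sin t₁ ^ 2 * Real.cos t₂ - 5 * Real.cos t₁ * Real.sin t₂ ^ 2) * z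
    + ((3 * Real.cos (2 * t₁) - 5 * Real.cos (2 * t₂) + 2) / 8)) /
  ((z ^ 2 - 2 * z * Real.cos t₁ + 1) ^ 2 * (z ^ 2 - 2 * z * Real.cos t₂ + 1) ^ 2)

/-- The Möbius self-map `T_q(z) = (z - q)/(1 - qz)` of the unit disk. -/
noncomputable def T (q z : ℂ) : ℂ := (z - q) / (1 - q * z)

lemma one_sub_real_mul_ne_zero {q : ℝ} (hq : q ∈ Set.Ioo (-1 : ℝ) 1) {z : ℂ} (hz : ‖z‖ ≤ 1) :
    1 - (q : ℂ) * z ≠ 0 := by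
  intro h
  have h1 : ‖(q : ℂ) * z‖ = 1 := by rw [← sub_eq_zero.mp h, norm_one]
  rw [norm_mul, Complex.norm_real, Real.norm_eq_abs] at h1
  nlinarith [abs_lt.mpr hq, abs_nonneg q, norm_nonneg z]

lemma one_add_sq_sub_two_mul_cos_pos {q : ℝ} (hq : q ∈ Set.Ioo (-1 : ℝ) 1) (t : ℝ) :
    0 < 1 + q ^ 2 - 2 * q * Real.cos t := by
  rcases le_total 0 q with h | h
  · nlinarith [mul_nonneg h (sub_nonneg.mpr (Real.cos_le_one t)), hq.2]
  · nlinarith [mul_nonneg (neg_nonneg.mpr h) (neg_le_iff_add_nonneg.mp (Real.neg_one_le_cos t)),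
      hq.1]

lemma cos_of_T_exp {q t s : ℝ} (hq : q ∈ Set.Ioo (-1 : ℝ) 1)
    (h : T q (Complex.exp (t * Complex.I)) = Complex.exp (s * Complex.I)) :
    Real.cos s = ((1 + q ^ 2) * Real.cos t - 2 * q) / (1 + q ^ 2 - 2 * q * Real.cos t) := by
  rw [eq_div_iff (one_add_sq_sub_two_mul_cos_pos hq t).ne']
  rw [T, div_eq_iff (one_sub_real_mul_ne_zero hq (Complex.norm_exp_ofReal_mul_I t).le),
    Complex.exp_mul_I, Complex.exp_mul_I, ← Complex.ofReal_cos, ← Complex.ofReal_sin,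
    ← Complex.ofReal_cos, ← Complex.ofReal_sin] at h
  have hre := congrArg Complex.re h
  have him := congrArg Complex.im h
  simp [-Complex.ofReal_cos, -Complex.ofReal_sin] at hre him
  linear_combination -(1 - q * Real.cos t) * hre + q * Real.sin t * him
    - (q ^ 2 * Real.cos s + q) * Real.sin_sq_add_cos_sq t

lemma quadratic_ne_zero {z : ℂ} (hz : ‖z‖ < 1) (t : ℝ) :
    z ^ 2 - 2 * z * Real.cos t + 1 ≠ 0 := by
  have key : z ^ 2 - 2 * z * Real.cos t + 1
      = (z - Complex.exp (t * Complex.I)) * (z - Complex.exp ((-t : ℝ) * Complex.I)) := by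
    rw [Complex.exp_mul_I, Complex.exp_mul_I]
    push_cast
    rw [Complex.cos_neg, Complex.sin_neg]
    linear_combination -Complex.sin_sq_add_cos_sq (t : ℂ) + Complex.sin (t : ℂ) ^ 2 * Complex.I_sq
  have hne (u : ℝ) : z - Complex.exp (u * Complex.I) ≠ 0 := by
    intro h
    rw [sub_eq_zero.mp h, Complex.norm_exp_ofReal_mul_I] at hz
    exact lt_irrefl _ hz
  rw [key]
  exact mul_ne_zero (hne t) (hne (-t))

lemma ψ₀_eq_partial_fractions (t₁ t₂ : ℝ) {z : ℂ} (h₁ : z ^ 2 - 2 * z * Real.cos t₁ + 1 ≠ 0)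
    (h₂ : z ^ 2 - 2 * z * Real.cos t₂ + 1 ≠ 0) :
    ψ₀ t₁ t₂ z =
      5 / 4 * ((1 - (Real.cos t₂ : ℂ) ^ 2) / (z ^ 2 - 2 * z * Real.cos t₂ + 1) ^ 2)
      - 3 / 4 * ((1 - (Real.cos t₁ : ℂ) ^ 2) / (z ^ 2 - 2 * z * Real.cos t₁ + 1) ^ 2) := by
  have hs (t : ℝ) : (Real.sin t : ℂ) ^ 2 = 1 - (Real.cos t : ℂ) ^ 2 := by
    exact_mod_cast Real.sin_sq t
  rw [ψ₀, hs, hs, Real.cos_two_mul, Real.cos_two_mul]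
  simp only [Complex.ofReal_sub, Complex.ofReal_mul, Complex.ofReal_pow]
  generalize (Real.cos t₁ : ℂ) = a at *
  generalize (Real.cos t₂ : ℂ) = b at *
  rw [← mul_div_assoc, ← mul_div_assoc, div_sub_div _ _ (pow_ne_zero 2 h₂) (pow_ne_zero 2 h₁),
    mul_comm ((z ^ 2 - 2 * z * b + 1) ^ 2)]
  congr 1
  · push_cast
    ring
  · ring

lemma quadratic_T {q t s : ℝ} (hq : q ∈ Set.Ioo (-1 : ℝ) 1)
    (h : T q (Complex.exp (t * Complex.I)) = Complex.exp (s * Complex.I)) {z : ℂ}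
    (hz : 1 - (q : ℂ) * z ≠ 0) :
    T q z ^ 2 - 2 * T q z * Real.cos s + 1 =
      (1 - (q : ℂ) ^ 2) ^ 2 * (z ^ 2 - 2 * z * Real.cos t + 1) /
        ((1 + (q : ℂ) ^ 2 - 2 * q * Real.cos t) * (1 - q * z) ^ 2) := by
  have hm : 1 + (q : ℂ) ^ 2 - 2 * q * (Real.cos t : ℂ) ≠ 0 := by
    exact_mod_cast (one_add_sq_sub_two_mul_cos_pos hq t).ne'
  rw [cos_of_T_exp hq h, T]
  simp only [Complex.ofReal_div, Complex.ofReal_sub, Complex.ofReal_mul, Complex.ofReal_add,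
    Complex.ofReal_pow]
  generalize (Real.cos t : ℂ) = a at *
  push_cast
  generalize hm' : 1 + (q : ℂ) ^ 2 - 2 * q * a = m at *
  generalize hd' : 1 - (q : ℂ) * z = d at *
  field_simp
  subst hm' hd'
  ring

lemma hasDerivAt_T {q z : ℂ} (hz : 1 - q * z ≠ 0) :
    HasDerivAt (T q) ((1 - q ^ 2) / (1 - q * z) ^ 2) z := by
  have h := ((hasDerivAt_id z).sub_const q).div
    (((hasDerivAt_id z).const_mul q).const_sub 1) hz
  exact h.congr_deriv (by simp only [id]; ring)

lemma one_sub_cos_sq_of_T_exp {q t s : ℝ} (hq : q ∈ Set.Ioo (-1 : ℝ) 1)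
    (h : T q (Complex.exp (t * Complex.I)) = Complex.exp (s * Complex.I)) :
    1 - (Real.cos s : ℂ) ^ 2 = (1 - (q : ℂ) ^ 2) ^ 2 * (1 - (Real.cos t : ℂ) ^ 2) /
      (1 + (q : ℂ) ^ 2 - 2 * q * Real.cos t) ^ 2 := by
  have hm := (one_add_sq_sub_two_mul_cos_pos hq t).ne'
  have key : 1 - Real.cos s ^ 2 = (1 - q ^ 2) ^ 2 * (1 - Real.cos t ^ 2) /
      (1 + q ^ 2 - 2 * q * Real.cos t) ^ 2 := by
    rw [cos_of_T_exp hq h]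
    generalize hm' : 1 + q ^ 2 - 2 * q * Real.cos t = m at *
    field_simp
    subst hm'
    ring
  exact_mod_cast congrArg Complex.ofReal key

lemma one_sub_real_sq_ne_zero {q : ℝ} (hq : q ∈ Set.Ioo (-1 : ℝ) 1) : 1 - (q : ℂ) ^ 2 ≠ 0 := by
  have h : 1 - q ^ 2 ≠ 0 := by nlinarith [hq.1, hq.2]
  exact_mod_cast h

lemma double_pole_pullback {q t s : ℝ} (hq : q ∈ Set.Ioo (-1 : ℝ) 1)
    (h : T q (Complex.exp (t * Complex.I)) = Complex.exp (s * Complex.I)) {z : ℂ} (hz : ‖z‖ < 1) :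
    (1 - (Real.cos s : ℂ) ^ 2) / (T q z ^ 2 - 2 * T q z * Real.cos s + 1) ^ 2
        * (deriv (T q) z) ^ 2 =
      (1 - (Real.cos t : ℂ) ^ 2) / (z ^ 2 - 2 * z * Real.cos t + 1) ^ 2 := by
  have hd := one_sub_real_mul_ne_zero hq hz.le
  have hm : 1 + (q : ℂ) ^ 2 - 2 * q * (Real.cos t : ℂ) ≠ 0 := by
    exact_mod_cast (one_add_sq_sub_two_mul_cos_pos hq t).ne'
  have hq2 := one_sub_real_sq_ne_zero hq
  have hQ := quadratic_ne_zero hz t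
  rw [quadratic_T hq h hd, (hasDerivAt_T hd).deriv, one_sub_cos_sq_of_T_exp hq h]
  generalize z ^ 2 - 2 * z * (Real.cos t : ℂ) + 1 = Q at *
  generalize 1 + (q : ℂ) ^ 2 - 2 * q * (Real.cos t : ℂ) = m at *
  generalize 1 - (q : ℂ) * z = d at *
  generalize 1 - (q : ℂ) ^ 2 = r at *
  field_simp

lemma quadratic_T_ne_zero {q t s : ℝ} (hq : q ∈ Set.Ioo (-1 : ℝ) 1)
    (h : T q (Complex.exp (t * Complex.I)) = Complex.exp (s * Complex.I)) {z : ℂ} (hz : ‖z‖ < 1) :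
    T q z ^ 2 - 2 * T q z * Real.cos s + 1 ≠ 0 := by
  have hd := one_sub_real_mul_ne_zero hq hz.le
  have hm : 1 + (q : ℂ) ^ 2 - 2 * q * (Real.cos t : ℂ) ≠ 0 := by
    exact_mod_cast (one_add_sq_sub_two_mul_cos_pos hq t).ne'
  rw [quadratic_T hq h hd]
  exact div_ne_zero (mul_ne_zero (pow_ne_zero 2 (one_sub_real_sq_ne_zero hq))
    (quadratic_ne_zero hz t)) (mul_ne_zero hm (pow_ne_zero 2 hd))

theorem psi0_pullback
    (t₁ t₂ t₁s t₂s q : ℝ)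
    (ht₁ : 0 < t₁) (ht₁₂ : t₁ < t₂) (ht₂ : t₂ < Real.pi)
    (hq : q ∈ Set.Ioo (-1 : ℝ) 1)
    (ht₁s : t₁s ∈ Set.Ioo 0 Real.pi) (ht₂s : t₂s ∈ Set.Ioo 0 Real.pi)
    (hT1 : T q (Complex.exp (t₁ * Complex.I)) = Complex.exp (t₁s * Complex.I))
    (hT2 : T q (Complex.exp (t₂ * Complex.I)) = Complex.exp (t₂s * Complex.I)) :
    ∀ z ∈ Metric.ball (0 : ℂ) 1,
      ψ₀ t₁ t₂ z = ψ₀ t₁s t₂s (T q z) * (deriv (T q) z) ^ 2 := by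
  intro z hz
  rw [mem_ball_zero_iff] at hz
  rw [ψ₀_eq_partial_fractions t₁ t₂ (quadratic_ne_zero hz t₁) (quadratic_ne_zero hz t₂),
    ψ₀_eq_partial_fractions t₁s t₂s (quadratic_T_ne_zero hq hT1 hz)
      (quadratic_T_ne_zero hq hT2 hz),
    ← double_pole_pullback hq hT1 hz, ← double_pole_pullback hq hT2 hz]
  ring
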